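/- arXiv:2510.17317 — 2 statements merged into one kernel-verified Lean document; each statement's English description precedes it below -/
import Mathlib

section
/- (Lemma 1: characterization of the symmetric subspace.) A vector v ∈ H satisfies U(φ) v = v for every cocycle φ ∈ Z^p(G) if and only if v lies in the range of the operator Σ_{k ∈ B_p(Ĝ)} P(k); equivalently, if and only if Σ_{k ∈ B_p(Ĝ)} P(k) v = v. -/
open Finset

set_option linter.unusedSectionVars false

noncomputable section

/-- The Pontryagin dual `Ĝ = Hom(G, ℝ/2πℤ)` of an abelian group `G`,
where `ℝ/2πℤ` is `Real.Angle = AddCircle (2π)`. -/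
abbrev PDual (G : Type) [AddCommGroup G] : Type := G →+ Real.Angle

/-- The dual of a finite abelian group is finite (hence all the `∑ᶠ` sums over
(subsets of) chain groups with coefficients in `PDual G` below are honest
finite sums). -/
instance PDual.finite (G : Type) [AddCommGroup G] [Fintype G] : Finite (PDual G) := by
  classical
  set n := Fintype.card G with hn
  have hn0 : 0 < n := Fintype.card_pos
  haveI : Fact (0 < 2 * Real.pi) := ⟨by positivity⟩
  have hT0 : Set.Finite {θ : AddCircle (2 * Real.pi) | n • θ = 0} := by
    have hU : Set.Finite
        (⋃ d ∈ Finset.Icc 1 n, {θ : AddCircle (2 * Real.pi) | addOrderOf θ = d}) :=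
      Set.Finite.biUnion (Finset.Icc 1 n).finite_toSet
        (fun d hd => AddCircle.finite_setOfPred_addOrderOf_eq (2 * Real.pi)
          (by simp only [Finset.coe_Icc, Set.mem_Icc] at hd; exact hd.1))
    refine hU.subset ?_
    intro θ hθ
    have hfin : IsOfFinAddOrder θ := by
      rw [isOfFinAddOrder_iff_nsmul_eq_zero]
      exact ⟨n, hn0, hθ⟩
    have hdvd : addOrderOf θ ∣ n := addOrderOf_dvd_of_nsmul_eq_zero hθ
    have hpos : 0 < addOrderOf θ := hfin.addOrderOf_pos
    refine Set.mem_iUnion₂.mpr ⟨addOrderOf θ, ?_, rfl⟩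
    simp only [Finset.mem_Icc]
    exact ⟨hpos, Nat.le_of_dvd hn0 hdvd⟩
  have hT : Set.Finite {θ : Real.Angle | n • θ = 0} := hT0
  haveI : Finite {θ : Real.Angle | n • θ = 0} := hT.to_subtype
  have hinj : Function.Injective
      (fun (k : G →+ Real.Angle) (g : G) =>
        (⟨k g, by
          show n • k g = 0
          rw [← map_nsmul, card_nsmul_eq_zero, map_zero]⟩ :
          {θ : Real.Angle | n • θ = 0})) := by
    intro k₁ k₂ h
    ext g
    have := congrFun h g
    simpa [Subtype.ext_iff] using this
  exact Finite.of_injective _ hinj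

/-- The well-defined complex exponential `e^{iθ} = cos θ + i sin θ` for `θ ∈ ℝ/2πℤ`. -/
def expA (θ : Real.Angle) : ℂ := Real.Angle.cos θ + Real.Angle.sin θ * Complex.I

variable {G : Type} [AddCommGroup G] [Fintype G]

/-- The pairing `⟨k, φ⟩ = ∑_{σ ∈ Δ} k(σ)(φ(σ))` with values in `ℝ/2πℤ`. -/
def pairing {Δ : Type} [Fintype Δ] (k : Δ → PDual G) (φ : Δ → G) : Real.Angle :=
  ∑ σ, k σ (φ σ)

/-- The boundary map `∂`, `(∂k')(σ) = ∑_τ s(τ,σ) • k'(τ)`; its image is the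
boundary group `B_p(Ĝ)` and its kernel the cycle group `Z_{p+1}(Ĝ)`. -/
def bd {A B : Type} [Fintype A] (s : A → B → ℤ) (k' : A → PDual G) : B → PDual G :=
  fun σ => ∑ τ, s τ σ • k' τ

/-- The coboundary map `δ`, `(δφ)(τ) = ∑_σ s(τ,σ) • φ(σ)`; its kernel is the
cocycle group `Z^p(G)` and its image the coboundary group `B^{p+1}(G)`. -/
def cb {A B : Type} [Fintype B] (s : A → B → ℤ) (φ : B → G) : A → G :=
  fun τ => ∑ σ, s τ σ • φ σ

variable {H : Type} [NormedAddCommGroup H] [InnerProductSpace ℂ H]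
  [FiniteDimensional ℂ H]

/-- The product of a pairwise-commuting finite family of operators. -/
def commProd {ι : Type} [Fintype ι] (f : ι → H →L[ℂ] H)
    (h : ∀ i j, Commute (f i) (f j)) : H →L[ℂ] H :=
  Finset.univ.noncommProd f (fun a _ b _ _ => h a b)

variable {Δp Δp1 : Type} [Fintype Δp] [Fintype Δp1]

/-- `U(φ) = ∏_{σ ∈ Δ^p} U_σ(φ(σ))`. -/
def Uop (U : Δp → G → H →L[ℂ] H)
    (hU : ∀ σ σ' g g', Commute (U σ g) (U σ' g')) (φ : Δp → G) : H →L[ℂ] H :=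
  commProd (fun σ => U σ (φ σ)) fun σ σ' => hU σ σ' _ _

/-- The local factor `|G|⁻¹ ∑_{g ∈ G} e^{−i k(σ)(g)} U_σ(g)` of `P(k)`. -/
def Pfactor (U : Δp → G → H →L[ℂ] H) (k : Δp → PDual G) (σ : Δp) : H →L[ℂ] H :=
  (Fintype.card G : ℂ)⁻¹ • ∑ g : G, expA (-(k σ g)) • U σ g

theorem Pfactor_commute (U : Δp → G → H →L[ℂ] H)
    (hU : ∀ σ σ' g g', Commute (U σ g) (U σ' g')) (k : Δp → PDual G)
    (σ σ' : Δp) : Commute (Pfactor U k σ) (Pfactor U k σ') := by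
  unfold Pfactor
  apply Commute.smul_left
  apply Commute.smul_right
  apply Commute.sum_left
  intro g _
  apply Commute.sum_right
  intro g' _
  exact ((hU σ σ' g g').smul_right _).smul_left _

/-- The projector `P(k) = ∏_{σ ∈ Δ^p} ( |G|⁻¹ ∑_{g ∈ G} e^{−i k(σ)(g)} U_σ(g) )`. -/
def Pop (U : Δp → G → H →L[ℂ] H)
    (hU : ∀ σ σ' g g', Commute (U σ g) (U σ' g')) (k : Δp → PDual G) : H →L[ℂ] H :=
  commProd (Pfactor U k) (Pfactor_commute U hU k)

/-- `Ũ(k') = ∏_{τ ∈ Δ^{p+1}} Ũ_τ(k'(τ))`. -/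
def Utop (Ut : Δp1 → PDual G → H →L[ℂ] H)
    (hUt : ∀ τ τ' ρ ρ', Commute (Ut τ ρ) (Ut τ' ρ')) (k' : Δp1 → PDual G) : H →L[ℂ] H :=
  commProd (fun τ => Ut τ (k' τ)) fun τ τ' => hUt τ τ' _ _

/-- The minimal coupling operator `𝒰 = ∑_{k ∈ B_p(Ĝ)} P(k) Ũ(r(k))`, for a fixed
section `r` of the boundary map. -/
def MC (s : Δp1 → Δp → ℤ) (U : Δp → G → H →L[ℂ] H)
    (hU : ∀ σ σ' g g', Commute (U σ g) (U σ' g'))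
    (Ut : Δp1 → PDual G → H →L[ℂ] H)
    (hUt : ∀ τ τ' ρ ρ', Commute (Ut τ ρ) (Ut τ' ρ'))
    (r : (Δp → PDual G) → (Δp1 → PDual G)) : H →L[ℂ] H :=
  ∑ᶠ k ∈ Set.range (bd (G := G) s), Pop U hU k * Utop Ut hUt (r k)

theorem expA_eq (θ : Real.Angle) : expA θ = (θ.toCircle : ℂ) := by
  rw [Real.Angle.coe_toCircle]; rfl

theorem expA_add (a b : Real.Angle) : expA (a + b) = expA a * expA b := by
  simp [expA_eq]

theorem expA_zero : expA 0 = 1 := by simp [expA_eq]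

theorem expA_inj {a b : Real.Angle} (h : expA a = expA b) : a = b := by
  rw [expA_eq, expA_eq] at h
  rw [← Real.Angle.arg_toCircle a, h, Real.Angle.arg_toCircle]

theorem expA_sum {ι : Type} (t : Finset ι) (f : ι → Real.Angle) :
    expA (∑ i ∈ t, f i) = ∏ i ∈ t, expA (f i) := by
  classical
  induction t using Finset.induction_on with
  | empty => simp [expA_zero]
  | insert a t ha ih => rw [sum_insert ha, prod_insert ha, expA_add, ih]

/-- The complex character attached to an element of the dual. -/
def dualChar (k : PDual G) : AddChar G ℂ where
  toFun g := expA (k g)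
  map_zero_eq_one' := by simp [expA_zero]
  map_add_eq_mul' a b := by simp [expA_add]

theorem dualChar_bij : Function.Bijective (dualChar (G := G)) := by
  constructor
  · intro a b h
    ext g
    exact expA_inj (DFunLike.congr_fun h g)
  · intro ψ
    have hne : ∀ g, ψ g ≠ 0 := fun g h => by
      have := ψ.norm_apply g
      rw [h] at this
      simp at this
    refine ⟨⟨⟨fun g => (Complex.arg (ψ g) : Real.Angle), by simp⟩, fun a b => ?_⟩, ?_⟩
    · show ((Complex.arg (ψ (a + b)) : ℝ) : Real.Angle) = _
      rw [AddChar.map_add_eq_mul, Complex.arg_mul_coe_angle (hne a) (hne b)]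
    · ext g
      show expA ((Complex.arg (ψ g) : ℝ) : Real.Angle) = ψ g
      rw [expA_eq, Real.Angle.toCircle_coe, Circle.coe_exp]
      have h := Complex.norm_mul_exp_arg_mul_I (ψ g)
      rw [ψ.norm_apply g] at h
      simpa using h

theorem sum_dual [Fintype (PDual G)] [DecidableEq G] (g : G) :
    ∑ χ : PDual G, expA (-(χ g)) = if g = 0 then (Fintype.card G : ℂ) else 0 := by
  have h := AddChar.sum_apply_eq_ite (-g)
  rw [← (Equiv.ofBijective _ (dualChar_bij (G := G))).sum_comp] at h
  simp only [neg_eq_zero] at h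
  rw [← h]
  refine Finset.sum_congr rfl fun χ _ => ?_
  show _ = expA (χ (-g))
  rw [map_neg]

theorem noncomm_prod_sum {R ι K : Type} [Ring R] [Fintype ι] [DecidableEq ι] [Fintype K]
    (F : ι → K → R) (hF : ∀ i j x y, Commute (F i x) (F j y))
    (c1 : ∀ k : ι → K, ((Finset.univ : Finset ι) : Set ι).Pairwise
      (Function.onFun Commute fun i => F i (k i)))
    (c2 : ((Finset.univ : Finset ι) : Set ι).Pairwise
      (Function.onFun Commute fun i => ∑ x, F i x)) :
    ∑ k : ι → K, Finset.univ.noncommProd (fun i => F i (k i)) (c1 k)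
      = Finset.univ.noncommProd (fun i => ∑ x, F i x) c2 := by
  let s : Set R := Set.range fun p : ι × K => F p.1 p.2
  have hs : ∀ a ∈ s, ∀ b ∈ s, a * b = b * a := by
    rintro _ ⟨p, rfl⟩ _ ⟨q, rfl⟩
    exact hF _ _ _ _
  have hcm : IsMulCommutative (Subring.closure s) := Subring.isMulCommutative_closure hs
  let inst : CommRing (Subring.closure s) :=
    { (inferInstance : Ring (Subring.closure s)) with mul_comm := hcm.is_comm.comm }
  let F' : ι → K → Subring.closure s := fun i x => ⟨F i x, Subring.subset_closure ⟨(i, x), rfl⟩⟩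
  let f : Subring.closure s →+* R := (Subring.closure s).subtype
  have hp : ∀ (g : ι → Subring.closure s) (c : ((Finset.univ : Finset ι) : Set ι).Pairwise
      (Function.onFun Commute fun i => f (g i))),
      f (∏ i, g i) = Finset.univ.noncommProd (fun i => f (g i)) c := by
    intro g c
    have h1 := Finset.noncommProd_eq_prod Finset.univ g
    refine Eq.trans (congrArg f h1.symm) ?_
    exact Finset.map_noncommProd Finset.univ g _ f
  have key := congrArg f (Finset.prod_univ_sum (fun _ : ι => (Finset.univ : Finset K)) F')
  rw [map_sum, Fintype.piFinset_univ] at key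
  have e : (fun i => f (∑ x, F' i x)) = fun i => ∑ x, F i x := by
    funext i
    rw [map_sum]
    rfl
  have e2 := hp (fun i => ∑ x, F' i x) (by rw [e]; exact c2)
  have e3 : Finset.univ.noncommProd (fun i => f (∑ x, F' i x)) (by rw [e]; exact c2)
      = Finset.univ.noncommProd (fun i => ∑ x, F i x) c2 :=
    Finset.noncommProd_congr rfl (fun i _ => congrFun e i) _
  rw [← e3]
  refine Eq.trans ?_ (key.symm.trans e2)
  refine Finset.sum_congr rfl fun k _ => ?_
  exact (hp (fun i => F' i (k i)) (c1 k)).symm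

theorem sum_Pop [Fintype (PDual G)] [DecidableEq Δp] (U : Δp → G → H →L[ℂ] H)
    (hU : ∀ σ σ' g g', Commute (U σ g) (U σ' g')) (hU0 : ∀ σ, U σ 0 = 1) :
    ∑ k : Δp → PDual G, Pop U hU k = 1 := by
  classical
  let F : Δp → PDual G → H →L[ℂ] H := fun σ χ => Pfactor U (fun _ => χ) σ
  have hF : ∀ i j x y, Commute (F i x) (F j y) := by
    intro i j x y
    show Commute (Pfactor U (fun _ => x) i) (Pfactor U (fun _ => y) j)
    unfold Pfactor
    refine (Commute.smul_left (Commute.smul_right ?_ _) _)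
    refine Commute.sum_left _ _ _ fun g _ => Commute.sum_right _ _ _ fun g' _ => ?_
    exact ((hU i j g g').smul_right _).smul_left _
  have h1 : ∀ σ, ∑ χ, F σ χ = 1 := by
    intro σ
    show ∑ χ : PDual G, (Fintype.card G : ℂ)⁻¹ • ∑ g : G, expA (-(χ g)) • U σ g = 1
    rw [← Finset.smul_sum, Finset.sum_comm]
    simp_rw [← Finset.sum_smul, sum_dual]
    simp [hU0]
  have c2 : ((Finset.univ : Finset Δp) : Set Δp).Pairwise
      (Function.onFun Commute fun i => ∑ x, F i x) := fun a _ b _ _ => by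
    show Commute (∑ x, F a x) (∑ x, F b x)
    rw [h1, h1]
  have h := noncomm_prod_sum F hF (fun k a _ b _ _ => hF a b _ _) c2
  refine Eq.trans h ?_
  refine (Finset.noncommProd_eq_pow_card _ _ _ 1 (fun σ _ => h1 σ)).trans (one_pow _)

theorem U_mul_Pfactor (U : Δp → G → H →L[ℂ] H)
    (hUhom : ∀ σ g g', U σ (g + g') = U σ g * U σ g') (k : Δp → PDual G) (σ : Δp) (g : G) :
    U σ g * Pfactor U k σ = expA (k σ g) • Pfactor U k σ := by
  unfold Pfactor
  rw [mul_smul_comm, smul_comm (expA (k σ g)), Finset.mul_sum]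
  congr 1
  rw [Finset.smul_sum,
    ← Fintype.sum_equiv (Equiv.addLeft g)
      (fun x => expA (k σ g) • expA (-(k σ (g + x))) • U σ (g + x))
      (fun x => expA (k σ g) • expA (-(k σ x)) • U σ x) (fun x => rfl)]
  refine Finset.sum_congr rfl fun x _ => ?_
  rw [mul_smul_comm, ← hUhom, smul_smul, ← expA_add]
  simp

theorem noncommProd_smul' {ι : Type} (t : Finset ι) (c : ι → ℂ) (f : ι → H →L[ℂ] H)
    (h1 : (t : Set ι).Pairwise (Function.onFun Commute fun i => c i • f i))
    (h : (t : Set ι).Pairwise (Function.onFun Commute f)) :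
    t.noncommProd (fun i => c i • f i) h1 = (∏ i ∈ t, c i) • t.noncommProd f h := by
  induction t using Finset.cons_induction_on with
  | empty => simp
  | cons a t ha ih =>
    rw [Finset.noncommProd_cons, Finset.noncommProd_cons, ih, Finset.prod_cons, smul_mul_smul_comm]

theorem U_comm_Pfactor (U : Δp → G → H →L[ℂ] H)
    (hU : ∀ σ σ' g g', Commute (U σ g) (U σ' g')) (k : Δp → PDual G) (σ σ' : Δp) (g : G) :
    Commute (U σ g) (Pfactor U k σ') := by
  unfold Pfactor
  refine Commute.smul_right ?_ _
  exact Commute.sum_right _ _ _ fun g' _ => (hU _ _ _ _).smul_right _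

theorem Uop_mul_Pop (U : Δp → G → H →L[ℂ] H)
    (hU : ∀ σ σ' g g', Commute (U σ g) (U σ' g'))
    (hUhom : ∀ σ g g', U σ (g + g') = U σ g * U σ g') (k : Δp → PDual G) (φ : Δp → G) :
    Uop U hU φ * Pop U hU k = expA (pairing k φ) • Pop U hU k := by
  unfold Uop Pop commProd pairing
  have hs : ∀ σ, ((fun σ => U σ (φ σ)) * Pfactor U k) σ = expA (k σ (φ σ)) • Pfactor U k σ :=
    fun σ => U_mul_Pfactor U hUhom k σ _
  rw [expA_sum]
  refine (Finset.noncommProd_mul_distrib (s := Finset.univ) (fun σ => U σ (φ σ)) (Pfactor U k)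
    _ _ (fun a _ b _ _ => (U_comm_Pfactor U hU k b a _).symm)).symm.trans ?_
  refine Eq.trans ?_ (noncommProd_smul' Finset.univ (fun σ => expA (k σ (φ σ))) (Pfactor U k)
    (fun a _ b _ _ => ((Pfactor_commute U hU k a b).smul_right _).smul_left _) _)
  exact Finset.noncommProd_congr rfl (fun σ _ => hs σ) _

theorem Uop_comm_Pop (U : Δp → G → H →L[ℂ] H)
    (hU : ∀ σ σ' g g', Commute (U σ g) (U σ' g')) (k : Δp → PDual G) (φ : Δp → G) :
    Commute (Uop U hU φ) (Pop U hU k) := by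
  unfold Uop Pop commProd
  refine Finset.noncommProd_commute _ _ _ _ fun σ _ => Commute.symm ?_
  exact Finset.noncommProd_commute _ _ _ _ fun σ' _ => (U_comm_Pfactor U hU k σ' σ _).symm

theorem pairing_bd (s : Δp1 → Δp → ℤ) (k' : Δp1 → PDual G) (φ : Δp → G) :
    pairing (bd s k') φ = pairing k' (cb s φ) := by
  unfold pairing bd cb
  simp only [map_sum, AddMonoidHom.finsetSum_apply, map_zsmul, AddMonoidHom.coe_smul,
    Pi.smul_apply]
  rw [Finset.sum_comm]

theorem mem_range_bd (s : Δp1 → Δp → ℤ) (k : Δp → PDual G)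
    (hk : ∀ φ : Δp → G, cb s φ = 0 → pairing k φ = 0) : k ∈ Set.range (bd (G := G) s) := by
  classical
  let δ : (Δp → G) →+ (Δp1 → G) :=
    { toFun := cb s
      map_zero' := by ext; simp [cb]
      map_add' := fun a b => by ext; simp [cb, Finset.sum_add_distrib] }
  let κ : (Δp → G) →+ Real.Angle :=
    { toFun := pairing k
      map_zero' := by simp [pairing]
      map_add' := fun a b => by simp [pairing, Finset.sum_add_distrib] }
  have hb : Module.Baer ℤ Real.Angle := by
    have : Fact (0 < 2 * Real.pi) := ⟨by positivity⟩
    have : DivisibleBy Real.Angle ℤ :=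
      inferInstanceAs (DivisibleBy (AddCircle (2 * Real.pi)) ℤ)
    exact Module.Baer.of_divisible _
  obtain ⟨h, hh⟩ := hb.extension_property_addMonoidHom (QuotientAddGroup.kerLift δ)
    (QuotientAddGroup.kerLift_injective δ) (QuotientAddGroup.lift δ.ker κ (fun φ hφ => hk φ hφ))
  have hh' : ∀ φ, h (cb s φ) = pairing k φ := fun φ =>
    DFunLike.congr_fun hh (φ : (Δp → G) ⧸ δ.ker)
  refine ⟨fun τ => h.comp (AddMonoidHom.single (fun _ => G) τ), ?_⟩
  funext σ
  ext g
  have e1 := hh' (Pi.single σ g)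
  have e2 : pairing k (Pi.single σ g) = k σ g := by
    unfold pairing
    rw [Finset.sum_eq_single σ]
    · simp
    · intro b _ hb; simp [Pi.single_eq_of_ne hb]
    · simp
  have e3 : cb s (Pi.single σ g) = ∑ τ, Pi.single τ (s τ σ • g) := by
    rw [Finset.univ_sum_single (fun τ => s τ σ • g)]
    funext τ
    unfold cb
    rw [Finset.sum_eq_single σ]
    · simp
    · intro b _ hb; simp [Pi.single_eq_of_ne hb]
    · simp
  rw [← e2, ← e1, e3, map_sum]
  unfold bd
  rw [AddMonoidHom.finsetSum_apply]
  refine Finset.sum_congr rfl fun τ _ => ?_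
  show s τ σ • h (Pi.single τ g) = _
  rw [Pi.single_zsmul, map_zsmul]

/-- **Lemma 1 (characterization of the symmetric subspace)**: a vector `v ∈ H`
satisfies `U(φ) v = v` for every cocycle `φ ∈ Z^p(G)` if and only if `v` lies in
the range of `∑_{k ∈ B_p(Ĝ)} P(k)`; equivalently, iff
`(∑_{k ∈ B_p(Ĝ)} P(k)) v = v`. -/
theorem symmetric_subspace_characterization
    (s : Δp1 → Δp → ℤ)
    (U : Δp → G → H →L[ℂ] H)
    (hU : ∀ σ σ' g g', Commute (U σ g) (U σ' g'))
    (hUhom : ∀ σ g g', U σ (g + g') = U σ g * U σ g')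
    (hU0 : ∀ σ, U σ 0 = 1)
    (hUunit : ∀ σ g, star (U σ g) * U σ g = 1 ∧ U σ g * star (U σ g) = 1)
    (v : H) :
    ((∀ φ : Δp → G, cb s φ = 0 → Uop U hU φ v = v) ↔
        v ∈ Set.range (∑ᶠ k ∈ Set.range (bd (G := G) s), Pop U hU k)) ∧
    ((∀ φ : Δp → G, cb s φ = 0 → Uop U hU φ v = v) ↔
        (∑ᶠ k ∈ Set.range (bd (G := G) s), Pop U hU k) v = v) := by
  classical
  letI : Fintype (PDual G) := Fintype.ofFinite _
  set B : Set (Δp → PDual G) := Set.range (bd (G := G) s) with hB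
  have hsum : (∑ᶠ k ∈ B, Pop U hU k) = ∑ k ∈ B.toFinset, Pop U hU k := by
    rw [finsum_mem_eq_toFinset_sum]
  have hfun : (∑ᶠ k ∈ B, ⇑(Pop U hU k)) = ⇑(∑ k ∈ B.toFinset, Pop U hU k) := by
    rw [finsum_mem_eq_toFinset_sum]
    funext w
    simp
  rw [hsum, hfun]
  have h1 : ∀ φ : Δp → G, cb s φ = 0 →
      Uop U hU φ * (∑ k ∈ B.toFinset, Pop U hU k) = ∑ k ∈ B.toFinset, Pop U hU k := by
    intro φ hφ
    rw [Finset.mul_sum]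
    refine Finset.sum_congr rfl fun k hk => ?_
    obtain ⟨k', rfl⟩ := Set.mem_toFinset.1 hk
    rw [Uop_mul_Pop U hU hUhom, pairing_bd, hφ]
    simp [pairing, expA_zero]
  have hA : v ∈ Set.range ⇑(∑ k ∈ B.toFinset, Pop U hU k : H →L[ℂ] H) →
      ∀ φ : Δp → G, cb s φ = 0 → Uop U hU φ v = v := by
    rintro ⟨w, rfl⟩ φ hφ
    exact DFunLike.congr_fun (h1 φ hφ) w
  have hC : (∀ φ : Δp → G, cb s φ = 0 → Uop U hU φ v = v) →
      (∑ k ∈ B.toFinset, Pop U hU k) v = v := by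
    intro hv
    have hall : (∑ k : Δp → PDual G, Pop U hU k) v = v := by
      rw [sum_Pop U hU hU0]; rfl
    refine Eq.trans ?_ hall
    rw [_root_.sum_apply, _root_.sum_apply]
    refine Finset.sum_subset (Finset.subset_univ _) fun k _ hk => ?_
    rw [Set.mem_toFinset] at hk
    have : ¬ ∀ φ : Δp → G, cb s φ = 0 → pairing k φ = 0 := fun h => hk (mem_range_bd s k h)
    push Not at this
    obtain ⟨φ, hφ, hne⟩ := this
    have e : Pop U hU k v = expA (pairing k φ) • Pop U hU k v := by
      have e1 := DFunLike.congr_fun (Uop_mul_Pop U hU hUhom k φ) v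
      rw [(Uop_comm_Pop U hU k φ).eq] at e1
      have e2 : (Pop U hU k) (Uop U hU φ v) = expA (pairing k φ) • Pop U hU k v := e1
      rwa [hv φ hφ] at e2
    have e3 : (1 - expA (pairing k φ)) • Pop U hU k v = 0 := by
      rw [sub_smul, one_smul, ← e, sub_self]
    rcases smul_eq_zero.1 e3 with h | h
    · exact absurd (expA_inj (by rw [expA_zero]; exact (sub_eq_zero.1 h).symm)) hne
    · exact h
  exact ⟨⟨fun h => ⟨v, hC h⟩, hA⟩, ⟨hC, fun h => hA ⟨v, h⟩⟩⟩
end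
end

section
/- (Well-definedness of the minimal coupling operator on the dual-symmetric subspace.) Let r and r' be two sections of the boundary map (∂(r(k)) = ∂(r'(k)) = k for all k ∈ B_p(Ĝ)), with associated operators 𝒰_r = Σ_{k ∈ B_p(Ĝ)} P(k) Ũ(r(k)) and 𝒰_{r'} = Σ_{k ∈ B_p(Ĝ)} P(k) Ũ(r'(k)). Then for every vector v ∈ H satisfying Ũ(k') v = v for all cycles k' ∈ Z_{p+1}(Ĝ), one has 𝒰_r v = 𝒰_{r'} v. -/
open Finset

set_option linter.unusedSectionVars false

noncomputable section

variable {G : Type} [AddCommGroup G] [Fintype G]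

variable {H : Type} [NormedAddCommGroup H] [InnerProductSpace ℂ H]
  [FiniteDimensional ℂ H]

variable {Δp Δp1 : Type} [Fintype Δp] [Fintype Δp1]

theorem Utop_add (Ut : Δp1 → PDual G → H →L[ℂ] H)
    (hUt : ∀ τ τ' ρ ρ', Commute (Ut τ ρ) (Ut τ' ρ'))
    (hUthom : ∀ τ ρ ρ', Ut τ (ρ + ρ') = Ut τ ρ * Ut τ ρ') (a b : Δp1 → PDual G) :
    Utop Ut hUt (a + b) = Utop Ut hUt a * Utop Ut hUt b := by
  have h := Finset.noncommProd_mul_distrib (s := (Finset.univ : Finset Δp1))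
    (fun τ => Ut τ (a τ)) (fun τ => Ut τ (b τ))
    (fun x _ y _ _ => hUt x y _ _) (fun x _ y _ _ => hUt x y _ _)
    (fun x _ y _ _ => hUt x y _ _)
  refine Eq.trans ?_ h
  exact Finset.noncommProd_congr rfl (fun τ _ => hUthom τ _ _)
    (fun x _ y _ _ => hUt x y _ _)

theorem bd_sub_aux (s : Δp1 → Δp → ℤ) (a b : Δp1 → PDual G) :
    bd s (a - b) = bd s a - bd s b := by
  funext σ
  simp [bd, smul_sub, Finset.sum_sub_distrib]

/-- **Well-definedness of the minimal coupling operator on the dual-symmetric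
subspace**: if `r` and `r'` are two sections of the boundary map, then the
associated operators `𝒰_r` and `𝒰_{r'}` agree on every vector `v` that is
invariant under all Wilson operators `Ũ(k')` labelled by cycles
`k' ∈ Z_{p+1}(Ĝ)`. -/
theorem minimal_coupling_well_defined
    (s : Δp1 → Δp → ℤ)
    (U : Δp → G → H →L[ℂ] H)
    (hU : ∀ σ σ' g g', Commute (U σ g) (U σ' g'))
    (hUhom : ∀ σ g g', U σ (g + g') = U σ g * U σ g')
    (hU0 : ∀ σ, U σ 0 = 1)
    (hUunit : ∀ σ g, star (U σ g) * U σ g = 1 ∧ U σ g * star (U σ g) = 1)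
    (Ut : Δp1 → PDual G → H →L[ℂ] H)
    (hUt : ∀ τ τ' ρ ρ', Commute (Ut τ ρ) (Ut τ' ρ'))
    (hUthom : ∀ τ ρ ρ', Ut τ (ρ + ρ') = Ut τ ρ * Ut τ ρ')
    (hUt0 : ∀ τ, Ut τ 0 = 1)
    (hUtunit : ∀ τ ρ, star (Ut τ ρ) * Ut τ ρ = 1 ∧ Ut τ ρ * star (Ut τ ρ) = 1)
    (hmix : ∀ σ τ g ρ, Commute (U σ g) (Ut τ ρ))
    (r r' : (Δp → PDual G) → (Δp1 → PDual G))
    (hr : ∀ k ∈ Set.range (bd (G := G) s), bd s (r k) = k)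
    (hr' : ∀ k ∈ Set.range (bd (G := G) s), bd s (r' k) = k)
    (v : H)
    (hv : ∀ k' : Δp1 → PDual G, bd s k' = 0 → Utop Ut hUt k' v = v) :
    MC s U hU Ut hUt r v = MC s U hU Ut hUt r' v := by
  unfold MC
  have hfin : (Set.range (bd (G := G) s)).Finite := Set.toFinite _
  rw [finsum_mem_eq_finite_toFinset_sum _ hfin, finsum_mem_eq_finite_toFinset_sum _ hfin,
    ContinuousLinearMap.sum_apply, ContinuousLinearMap.sum_apply]
  refine Finset.sum_congr rfl fun k hk => ?_
  have hk' : k ∈ Set.range (bd (G := G) s) := hfin.mem_toFinset.mp hk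
  have h0 : bd s (r k - r' k) = 0 := by
    rw [bd_sub_aux, hr k hk', hr' k hk', sub_self]
  have h1 : Utop Ut hUt (r k) v = Utop Ut hUt (r' k) v := by
    have h2 : r k = r' k + (r k - r' k) := by abel
    rw [h2, Utop_add Ut hUt hUthom, ContinuousLinearMap.mul_apply, hv _ h0]
  rw [ContinuousLinearMap.mul_apply, ContinuousLinearMap.mul_apply, h1]
end
end
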